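/- arXiv:1604.03270 — 5 statements merged into one kernel-verified Lean document; each statement's English description precedes it below -/
import Mathlib

section
/- Let A=(Q,Σ,δ,ρ) be an invertible and reversible Mealy automaton. The group ⟨A⟩ generated by A is finite if and only if the sizes of the connected components of the powers A^n are bounded, i.e., if and only if there exists B such that for every n≥1 every connected component of A^n has at most B states. -/
open List

variable {Q A : Type*}

/-- Action of a state on words over the alphabet:
`ρ_x(i·s) = ρ_x(i) · ρ_{δ_i(x)}(s)`. -/
def mrho (d : A → Q → Q) (r : Q → A → A) : Q → List A → List A
  | _, [] => []
  | x, i :: s => r x i :: mrho d r (d i x) s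

/-- Action of a word of states: `ρ_{x₁⋯x_m} = ρ_{x_m} ∘ ⋯ ∘ ρ_{x₁}`. -/
def mrhoW (d : A → Q → Q) (r : Q → A → A) : List Q → List A → List A
  | [], s => s
  | x :: u, s => mrhoW d r u (mrho d r x s)

/-- Dual action of a letter on words of states:
`δ_i(x·u) = δ_i(x) · δ_{ρ_x(i)}(u)`. -/
def mdel (d : A → Q → Q) (r : Q → A → A) : A → List Q → List Q
  | _, [] => []
  | i, x :: u => d i x :: mdel d r (r x i) u

/-- Action of a word of letters: `δ_{s₁⋯s_m} = δ_{s_m} ∘ ⋯ ∘ δ_{s₁}`. -/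
def mdelW (d : A → Q → Q) (r : Q → A → A) : List A → List Q → List Q
  | [], u => u
  | i :: s, u => mdelW d r s (mdel d r i u)

/-- Connected component (orbit under the dual action) of a word of states. -/
def mOrbit (d : A → Q → Q) (r : Q → A → A) (u : List Q) : Set (List Q) :=
  { v | ∃ s : List A, mdelW d r s u = v }

/-- The Mealy automaton is invertible. -/
def MInvertible (r : Q → A → A) : Prop := ∀ x : Q, Function.Bijective (r x)

/-- The Mealy automaton is reversible. -/
def MReversible (d : A → Q → Q) : Prop := ∀ i : A, Function.Bijective (d i)

/-- The Mealy automaton is connected. -/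
def MConnected (d : A → Q → Q) (r : Q → A → A) : Prop :=
  ∀ x y : Q, ∃ s : List A, mdelW d r s [x] = [y]

/-- The Mealy automaton is bireversible: invertible, reversible, and for each output
letter `j`, the map sending `x` to `δ_i(x)` (where `i` is the unique letter with
`ρ_x(i) = j`) is a permutation of the (finite) stateset, encoded as injectivity. -/
def MBireversible (d : A → Q → Q) (r : Q → A → A) : Prop :=
  MInvertible r ∧ MReversible d ∧
    ∀ (x y : Q) (i i' : A), r x i = r y i' → d i x = d i' y → x = y

/-- The edge of the orbit tree whose bottom is the component of `e` is liftable
to the edge whose bottom is the component of `f`: every word of `⊥(e)` admits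
some word of `⊥(f)` as a suffix. -/
def EdgeLiftable (d : A → Q → Q) (r : Q → A → A) (e f : List Q) : Prop :=
  ∀ v ∈ mOrbit d r e, ∃ v' ∈ mOrbit d r f, v' <:+ v

theorem mrhoW_append_aux (d : A → Q → Q) (r : Q → A → A) (u v : List Q) (s : List A) :
    mrhoW d r (u ++ v) s = mrhoW d r v (mrhoW d r u s) := by
  induction u generalizing s with
  | nil => rfl
  | cons x u ih => simp [mrhoW, ih]

def dq (d : A → Q → Q) : List A → Q → Q
  | [], x => x
  | i :: s, x => dq d s (d i x)

theorem mdelW_nil_aux (d : A → Q → Q) (r : Q → A → A) (s : List A) : mdelW d r s [] = [] := by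
  induction s with
  | nil => rfl
  | cons i s ih => simpa [mdelW, mdel] using ih

theorem mdelW_cons_aux (d : A → Q → Q) (r : Q → A → A) (s : List A) (x : Q) (u : List Q) :
    mdelW d r s (x :: u) = dq d s x :: mdelW d r (mrho d r x s) u := by
  induction s generalizing x u with
  | nil => rfl
  | cons i s ih => simp [mdelW, mdel, dq, mrho, ih]

theorem mdelW_length_aux (d : A → Q → Q) (r : Q → A → A) (s : List A) (u : List Q) :
    (mdelW d r s u).length = u.length := by
  induction u generalizing s with
  | nil => simp [mdelW_nil_aux]
  | cons x u ih => simp [mdelW_cons_aux, ih]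

theorem mdelW_congr_aux (d : A → Q → Q) (r : Q → A → A) (u : List Q) (s s' : List A)
    (h : ∀ v x, dq d (mrhoW d r v s) x = dq d (mrhoW d r v s') x) :
    mdelW d r s u = mdelW d r s' u := by
  induction u generalizing s s' with
  | nil => simp [mdelW_nil_aux]
  | cons x u ih =>
    rw [mdelW_cons_aux, mdelW_cons_aux, ih _ _ (fun v y => h (x :: v) y)]
    congr 1
    exact h [] x

/-- one-letter action of a word of states -/
def rW (r : Q → A → A) (d : A → Q → Q) : List Q → A → A
  | [], i => i
  | x :: u, i => rW r d u (r x i)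

theorem mrhoW_nil_aux (d : A → Q → Q) (r : Q → A → A) (u : List Q) : mrhoW d r u [] = [] := by
  induction u with
  | nil => rfl
  | cons i s ih => simpa [mrhoW, mrho] using ih

theorem mrhoW_cons_aux (d : A → Q → Q) (r : Q → A → A) (u : List Q) (i : A) (s : List A) :
    mrhoW d r u (i :: s) = rW r d u i :: mrhoW d r (mdel d r i u) s := by
  induction u generalizing i s with
  | nil => rfl
  | cons x u ih => simp [mrhoW, mrho, rW, mdel, ih]

/-- Run an abstract automaton. -/
def runA {S : Type*} (t : S → A → S) (o : S → A → A) : S → List A → List A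
  | _, [] => []
  | q, i :: s => o q i :: runA t o (t q i) s

theorem mOrbit_finite_aux [Fintype Q] (d : A → Q → Q) (r : Q → A → A) (u : List Q) :
    (mOrbit d r u).Finite := by
  refine (List.finite_length_eq Q u.length).subset ?_
  rintro v ⟨s, rfl⟩
  exact mdelW_length_aux d r s u

theorem mdel_mem_aux (d : A → Q → Q) (r : Q → A → A) (u v : List Q) (i : A)
    (hv : v ∈ mOrbit d r u) : mdel d r i v ∈ mOrbit d r u := by
  obtain ⟨s, rfl⟩ := hv
  refine ⟨s ++ [i], ?_⟩
  induction s generalizing u with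
  | nil => rfl
  | cons j s ih => simpa [mdelW] using ih (mdel d r j u)

theorem bounded_finite_aux [Fintype Q] [Fintype A] (d : A → Q → Q) (r : Q → A → A) (B : ℕ)
    (hB : ∀ u : List Q, (mOrbit d r u).ncard ≤ B) : (Set.range (mrhoW d r)).Finite := by
  let D := (Fin (B+1) → A → Fin (B+1)) × (Fin (B+1) → A → A) × Fin (B+1)
  refine (Set.finite_range (fun p : D => runA p.1 p.2.1 p.2.2)).subset ?_
  rintro _ ⟨u, rfl⟩
  have hfin := mOrbit_finite_aux d r u
  have := hfin.to_subtype
  have hc : Nat.card (mOrbit d r u) ≤ B := hB u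
  let e0 := Finite.equivFin (mOrbit d r u)
  let e : mOrbit d r u → Fin (B+1) := fun v => Fin.castLE (by omega) (e0 v)
  have he : Function.Injective e := (Fin.castLE_injective _).comp e0.injective
  let u0 : mOrbit d r u := ⟨u, [], rfl⟩
  have : Nonempty (mOrbit d r u) := ⟨u0⟩
  let g := Function.invFun e
  have hg : ∀ v, g (e v) = v := Function.leftInverse_invFun he
  refine ⟨(fun q i => e ⟨mdel d r i (g q), mdel_mem_aux d r u _ i (g q).2⟩,
    fun q i => rW r d (g q) i, e u0), ?_⟩
  funext s
  have key : ∀ (s : List A) (v : mOrbit d r u),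
      runA (fun q i => e ⟨mdel d r i (g q), mdel_mem_aux d r u _ i (g q).2⟩)
        (fun q i => rW r d (g q) i) (e v) s = mrhoW d r v s := by
    intro s
    induction s with
    | nil => intro v; simp [runA, mrhoW_nil_aux]
    | cons i s ih =>
      intro v
      rw [mrhoW_cons_aux, runA, ih, hg]
  exact key s u0

theorem finite_bounded_aux [Fintype Q] (d : A → Q → Q) (r : Q → A → A)
    (h : (Set.range (mrhoW d r)).Finite) : ∃ B : ℕ, ∀ u, (mOrbit d r u).ncard ≤ B := by
  have := h.to_subtype
  refine ⟨Nat.card (Set.range (mrhoW d r) → Q → Q), fun u => ?_⟩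
  let F : List A → (Set.range (mrhoW d r) → Q → Q) := fun s g x => dq d (g.1 s) x
  have hF : Function.FactorsThrough (fun s => mdelW d r s u) F := by
    intro s s' hs
    apply mdelW_congr_aux
    intro v x
    exact congrFun (congrFun hs ⟨_, v, rfl⟩) x
  let E := Function.extend F (fun s => mdelW d r s u) (fun _ => [])
  have hsub : mOrbit d r u ⊆ Set.range E := by
    rintro v ⟨s, rfl⟩
    exact ⟨F s, hF.extend_apply _ s⟩
  calc (mOrbit d r u).ncard ≤ (Set.range E).ncard := Set.ncard_le_ncard hsub (Set.finite_range E)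
    _ ≤ _ := by
      rw [← Set.image_univ, ← Set.ncard_univ]
      exact Set.ncard_image_le Set.finite_univ

theorem mrho_bij_aux (d : A → Q → Q) (r : Q → A → A) (hinv : MInvertible r) (x : Q) :
    Function.Bijective (mrho d r x) := by
  constructor
  · intro s
    induction s generalizing x with
    | nil => intro t h; cases t <;> simp_all [mrho]
    | cons i s ih =>
      intro t h
      cases t with
      | nil => simp [mrho] at h
      | cons j t =>
        simp only [mrho, List.cons.injEq] at h
        obtain rfl := (hinv x).1 h.1
        rw [ih _ h.2]
  · intro t
    induction t generalizing x with
    | nil => exact ⟨[], rfl⟩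
    | cons j t ih =>
      obtain ⟨i, rfl⟩ := (hinv x).2 j
      obtain ⟨s, rfl⟩ := ih (d i x)
      exact ⟨i :: s, rfl⟩

theorem group_iff_aux (d : A → Q → Q) (r : Q → A → A) (hinv : MInvertible r) :
    Finite ↥(Subgroup.closure {σ : Equiv.Perm (List A) | ∃ x : Q, ⇑σ = mrho d r x}) ↔
      (Set.range (mrhoW d r)).Finite := by
  set S := {σ : Equiv.Perm (List A) | ∃ x : Q, ⇑σ = mrho d r x} with hS
  constructor
  · intro hfin
    refine (Set.finite_range
      (fun g : Subgroup.closure S => (⇑(g : Equiv.Perm (List A)) : List A → List A))).subset ?_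
    rintro _ ⟨u, rfl⟩
    induction u with
    | nil => exact ⟨1, rfl⟩
    | cons x u ih =>
      obtain ⟨g, hg⟩ := ih
      let σ : Subgroup.closure S := ⟨Equiv.ofBijective _ (mrho_bij_aux d r hinv x),
        Subgroup.subset_closure ⟨x, rfl⟩⟩
      refine ⟨g * σ, ?_⟩
      funext s
      exact congrFun hg (mrho d r x s)
  · intro hfin
    have hM : ((Submonoid.closure S : Submonoid (Equiv.Perm (List A))) : Set (Equiv.Perm (List A))).Finite := by
      refine Set.Finite.subset (hfin.preimage (f := fun σ : Equiv.Perm (List A) => ⇑σ)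
        DFunLike.coe_injective.injOn) ?_
      intro σ hσ
      change ∃ u, mrhoW d r u = ⇑σ
      induction hσ using Submonoid.closure_induction with
      | mem σ h => obtain ⟨x, hx⟩ := h; exact ⟨[x], by rw [hx]; rfl⟩
      | one => exact ⟨[], rfl⟩
      | mul σ τ _ _ h1 h2 =>
        obtain ⟨u, hu⟩ := h1
        obtain ⟨v, hv⟩ := h2
        refine ⟨v ++ u, ?_⟩
        funext s
        rw [mrhoW_append_aux, hu, hv]; rfl
    have hord : ∀ σ ∈ S, IsOfFinOrder σ := by
      intro σ hσ
      rw [← finite_powers]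
      refine hM.subset ?_
      exact Submonoid.powers_le.2 (Submonoid.subset_closure hσ)
    have heq := Subgroup.closure_toSubmonoid_of_isOfFinOrder hord
    have : ((Subgroup.closure S : Subgroup (Equiv.Perm (List A))) : Set (Equiv.Perm (List A))).Finite := by
      rw [← Subgroup.coe_toSubmonoid, heq]; exact hM
    exact this.to_subtype

/-- The group generated by an invertible-reversible Mealy automaton is finite iff the
sizes of the connected components of the powers `A^n` are bounded. -/
theorem statement1 [Fintype Q] [Fintype A] [Nonempty Q] [Nonempty A]
    (d : A → Q → Q) (r : Q → A → A)
    (hinv : MInvertible r) (hrev : MReversible d) :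
    Finite ↥(Subgroup.closure {σ : Equiv.Perm (List A) | ∃ x : Q, ⇑σ = mrho d r x}) ↔
      ∃ B : ℕ, ∀ n : ℕ, 1 ≤ n → ∀ u : List Q, u.length = n → (mOrbit d r u).ncard ≤ B := by
  rw [group_iff_aux d r hinv]
  constructor
  · intro h
    obtain ⟨B, hB⟩ := finite_bounded_aux d r h
    exact ⟨B, fun n _ u _ => hB u⟩
  · rintro ⟨B, hB⟩
    refine bounded_finite_aux d r (B + 1) fun u => ?_
    rcases u with _ | ⟨x, u⟩
    · have : mOrbit d r [] ⊆ {[]} := by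
        rintro v ⟨s, rfl⟩
        exact mdelW_nil_aux d r s
      have := Set.ncard_le_ncard this (Set.finite_singleton _)
      rw [Set.ncard_singleton] at this
      omega
    · exact (hB _ (by simp) (x :: u) rfl).trans (Nat.le_succ B)
end

section
/- Let A=(Q,Σ,δ,ρ) be an invertible and reversible Mealy automaton and let u∈Q^+ be a non-empty word. The following conditions are equivalent: (i) the map ρ_u : Σ*→Σ* has finite order; (ii) the sizes of the connected components of the words u^n (n∈ℕ) are bounded; (iii) there exists a word v∈Q* such that the sizes of the connected components of the words v·u^n (n∈ℕ) are bounded; (iv) for every word v∈Q*, the sizes of the connected components of the words v·u^n (n∈ℕ) are bounded. -/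
open List

variable {Q A : Type*}

section Helpers

variable {Q A : Type*} (d : A → Q → Q) (r : Q → A → A)

/-- Action of a word of states on a letter. -/
def mact : List Q → A → A
  | [], i => i
  | x :: u, i => mact u (r x i)

/-- Powers of a word. -/
def mpw (u : List Q) (m : ℕ) : List Q := List.flatten (List.replicate m u)

theorem mdel_length (i : A) (u : List Q) : (mdel d r i u).length = u.length := by
  induction u generalizing i with
  | nil => rfl
  | cons x u ih => simp [mdel, ih]

theorem mdelW_length (s : List A) (u : List Q) : (mdelW d r s u).length = u.length := by
  induction s generalizing u with
  | nil => rfl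
  | cons i s ih => simp [mdelW, ih, mdel_length]

theorem mrhoW_nil (w : List Q) : mrhoW d r w [] = [] := by
  induction w with
  | nil => rfl
  | cons x u ih => simpa [mrhoW, mrho] using ih

theorem mrhoW_cons (w : List Q) (i : A) (s : List A) :
    mrhoW d r w (i :: s) = mact r w i :: mrhoW d r (mdel d r i w) s := by
  induction w generalizing i s with
  | nil => rfl
  | cons x u ih => simp [mrhoW, mrho, mact, mdel, ih]

theorem mrhoW_append (w z : List Q) (s : List A) :
    mrhoW d r (w ++ z) s = mrhoW d r z (mrhoW d r w s) := by
  induction w generalizing s with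
  | nil => rfl
  | cons x u ih => simp [mrhoW, ih]

theorem mdel_append (i : A) (w z : List Q) :
    mdel d r i (w ++ z) = mdel d r i w ++ mdel d r (mact r w i) z := by
  induction w generalizing i with
  | nil => rfl
  | cons x u ih => simp [mdel, mact, ih]

theorem mdelW_append (s : List A) (w z : List Q) :
    mdelW d r s (w ++ z) = mdelW d r s w ++ mdelW d r (mrhoW d r w s) z := by
  induction s generalizing w z with
  | nil => simp [mdelW, mrhoW_nil]
  | cons i s ih => simp [mdelW, mdel_append, ih, mrhoW_cons]

theorem mdelW_nil (s : List A) : mdelW d r s [] = [] := by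
  have := mdelW_length d r s []
  simpa using this

theorem mpw_succ (u : List Q) (m : ℕ) : mpw u (m + 1) = u ++ mpw u m := by
  simp [mpw, List.replicate_succ]

theorem mpw_add (u : List Q) (m n : ℕ) : mpw u (m + n) = mpw u m ++ mpw u n := by
  unfold mpw
  rw [List.replicate_add, List.flatten_append]

theorem mpw_mul (u : List Q) (k m : ℕ) : mpw u (k * m) = mpw (mpw u k) m := by
  induction m with
  | zero => simp [mpw]
  | succ m ih => rw [mpw_succ, Nat.mul_succ, Nat.add_comm, mpw_add, ih]

theorem mrhoW_pw (u : List Q) (m : ℕ) : mrhoW d r (mpw u m) = (mrhoW d r u)^[m] := by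
  induction m with
  | zero => rfl
  | succ m ih =>
    funext s
    rw [mpw_succ, mrhoW_append, ih]; rfl

theorem mdelW_pw_of_id (w : List Q) (h : mrhoW d r w = id) (s : List A) (m : ℕ) :
    mdelW d r s (mpw w m) = mpw (mdelW d r s w) m := by
  induction m with
  | zero => exact mdelW_nil d r s
  | succ m ih => rw [mpw_succ, mpw_succ, mdelW_append, h, id, ih]

theorem mrho_surj (hinv : MInvertible r) (x : Q) : Function.Surjective (mrho d r x) := by
  intro s
  induction s generalizing x with
  | nil => exact ⟨[], rfl⟩
  | cons j s ih =>
    obtain ⟨i, rfl⟩ := (hinv x).2 j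
    obtain ⟨t, rfl⟩ := ih (d i x)
    exact ⟨i :: t, rfl⟩

theorem mrhoW_surj (hinv : MInvertible r) (w : List Q) : Function.Surjective (mrhoW d r w) := by
  induction w with
  | nil => exact fun s => ⟨s, rfl⟩
  | cons x u ih => exact ih.comp (mrho_surj d r hinv x)

theorem mOrbit_finite [Fintype Q] (w : List Q) : (mOrbit d r w).Finite := by
  refine (List.finite_length_eq Q w.length).subset ?_
  rintro _ ⟨s, rfl⟩
  exact mdelW_length d r s w

theorem mOrbit_take (w z : List Q) :
    (fun x => List.take w.length x) '' mOrbit d r (w ++ z) = mOrbit d r w := by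
  have key : ∀ s, List.take w.length (mdelW d r s (w ++ z)) = mdelW d r s w := by
    intro s
    rw [mdelW_append, List.take_left' (mdelW_length d r s w)]
  ext x
  constructor
  · rintro ⟨_, ⟨s, rfl⟩, rfl⟩
    exact ⟨s, (key s).symm⟩
  · rintro ⟨s, rfl⟩
    exact ⟨_, ⟨s, rfl⟩, key s⟩

theorem mrhoW_congr (w w' : List Q)
    (h : ∀ s, mact r (mdelW d r s w) = mact r (mdelW d r s w')) :
    mrhoW d r w = mrhoW d r w' := by
  funext s
  induction s generalizing w w' with
  | nil => simp [mrhoW_nil]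
  | cons i s ih =>
    rw [mrhoW_cons, mrhoW_cons, ih _ _ (fun t => h (i :: t))]
    congr 1
    exact congrFun (h []) i

theorem bounded_of_order [Fintype Q] (u v : List Q) (k : ℕ) (hk : 1 ≤ k)
    (h : (mrhoW d r u)^[k] = id) :
    ∃ B : ℕ, ∀ m : ℕ, (mOrbit d r (v ++ mpw u m)).ncard ≤ B := by
  have hF := (List.finite_length_eq Q v.length).prod (List.finite_length_eq Q (mpw u k).length)
  refine ⟨_, fun m => le_trans (Set.ncard_le_ncard (t := (fun p : List Q × List Q =>
    p.1 ++ List.take (mpw u m).length (mpw p.2 m)) '' _) ?_ (hF.image _))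
    (Set.ncard_image_le hF)⟩
  rintro _ ⟨s, rfl⟩
  refine ⟨(mdelW d r s v, mdelW d r (mrhoW d r v s) (mpw u k)),
    ⟨mdelW_length _ _ _ _, mdelW_length _ _ _ _⟩, ?_⟩
  have hkm : k * m = m + (k * m - m) := by
    have : m ≤ k * m := Nat.le_mul_of_pos_left m hk
    omega
  simp only
  rw [mdelW_append, ← mdelW_pw_of_id d r _ (by rw [mrhoW_pw, h]), ← mpw_mul, hkm, mpw_add,
    mdelW_append, List.take_left' (mdelW_length d r _ _)]

theorem order_of_bounded [Fintype Q] [Fintype A] (hinv : MInvertible r) (u v : List Q) (B : ℕ)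
    (hB : ∀ m : ℕ, (mOrbit d r (v ++ mpw u m)).ncard ≤ B) :
    ∃ k : ℕ, 1 ≤ k ∧ (mrhoW d r u)^[k] = id := by
  obtain ⟨N, hN⟩ : ∃ N, ∀ m, (mOrbit d r (v ++ mpw u m)).ncard
      ≤ (mOrbit d r (v ++ mpw u N)).ncard := by
    have hne : (Set.range fun m => (mOrbit d r (v ++ mpw u m)).ncard).Nonempty := ⟨_, 0, rfl⟩
    have hbd : BddAbove (Set.range fun m => (mOrbit d r (v ++ mpw u m)).ncard) :=
      ⟨B, by rintro _ ⟨m, rfl⟩; exact hB m⟩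
    obtain ⟨N, hN⟩ := Nat.sSup_mem hne hbd
    exact ⟨N, fun m => (le_csSup hbd ⟨m, rfl⟩).trans hN.ge⟩
  set w := v ++ mpw u N with hw
  have hsplit : ∀ m, v ++ mpw u (N + m) = w ++ mpw u m := by
    intro m; rw [mpw_add, hw, List.append_assoc]
  clear_value w
  have hdet : ∀ m s t, mdelW d r s w = mdelW d r t w →
      mdelW d r s (w ++ mpw u m) = mdelW d r t (w ++ mpw u m) := by
    intro m s t hst
    have hfin := mOrbit_finite d r (w ++ mpw u m)
    have hinj := Set.injOn_of_ncard_image_eq (f := fun x => List.take w.length x)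
      (s := mOrbit d r (w ++ mpw u m)) (le_antisymm (Set.ncard_image_le hfin) (by
        rw [mOrbit_take, ← hsplit]; exact hN _)) hfin
    refine hinj ⟨s, rfl⟩ ⟨t, rfl⟩ ?_
    simp only
    rw [mdelW_append, mdelW_append, List.take_left' (mdelW_length d r s w),
      List.take_left' (mdelW_length d r t w), hst]
  have : Finite (mOrbit d r w) := (mOrbit_finite d r w).to_subtype
  let g : ℕ → (mOrbit d r w → A → A) := fun m x =>
    mact r (mdelW d r x.2.choose (w ++ mpw u m))
  have hg : ∀ m s, g m ⟨mdelW d r s w, s, rfl⟩ = mact r (mdelW d r s (w ++ mpw u m)) := by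
    intro m s
    have hc : ∃ t, mdelW d r t w = mdelW d r s w := ⟨s, rfl⟩
    change mact r (mdelW d r hc.choose (w ++ mpw u m)) = _
    rw [hdet m _ _ hc.choose_spec]
  obtain ⟨a, b, hab, hgab⟩ : ∃ a b, a < b ∧ g a = g b := by
    obtain ⟨a, b, hne, h⟩ := Finite.exists_ne_map_eq_of_infinite g
    rcases lt_or_gt_of_ne hne with hlt | hlt
    · exact ⟨a, b, hlt, h⟩
    · exact ⟨b, a, hlt, h.symm⟩
  have heq : mrhoW d r (w ++ mpw u a) = mrhoW d r (w ++ mpw u b) :=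
    mrhoW_congr d r _ _ fun s => by rw [← hg, ← hg, hgab]
  refine ⟨b - a, by omega, ?_⟩
  funext s
  obtain ⟨t, rfl⟩ := mrhoW_surj d r hinv (w ++ mpw u a) s
  rw [← mrhoW_pw, ← mrhoW_append, List.append_assoc, ← mpw_add,
    show a + (b - a) = b by omega, heq, id]

end Helpers

/-- For an invertible-reversible Mealy automaton and a non-empty word `u` of states,
the following are equivalent: (i) `ρ_u` has finite order; (ii) the sizes of the connected
components of the `u^m` are bounded; (iii) for some `v` the sizes of the components of
the `v·u^m` are bounded; (iv) for every `v` the sizes of the components of the `v·u^m`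
are bounded. -/
theorem statement2 [Fintype Q] [Fintype A] [Nonempty Q] [Nonempty A]
    (d : A → Q → Q) (r : Q → A → A)
    (hinv : MInvertible r) (hrev : MReversible d)
    (u : List Q) (hu : u ≠ []) :
    List.TFAE
      [ ∃ k : ℕ, 1 ≤ k ∧ (mrhoW d r u)^[k] = id,
        ∃ B : ℕ, ∀ m : ℕ, (mOrbit d r (List.flatten (List.replicate m u))).ncard ≤ B,
        ∃ v : List Q, ∃ B : ℕ, ∀ m : ℕ,
          (mOrbit d r (v ++ List.flatten (List.replicate m u))).ncard ≤ B,
        ∀ v : List Q, ∃ B : ℕ, ∀ m : ℕ,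
          (mOrbit d r (v ++ List.flatten (List.replicate m u))).ncard ≤ B ] := by
  tfae_have 1 → 4 := by
    rintro ⟨k, hk, h⟩ v
    exact bounded_of_order d r u v k hk h
  tfae_have 4 → 2 := fun h => by simpa using h []
  tfae_have 2 → 3 := fun h => ⟨[], by simpa using h⟩
  tfae_have 3 → 1 := by
    rintro ⟨v, B, h⟩
    exact order_of_bounded d r hinv u v B h
  tfae_finish
end

section
/- Let A be a reversible Mealy automaton and let e and f be two edges in the orbit tree o(A). If there exists a word of ⊥(e) which admits a word of ⊥(f) as a suffix, then e is liftable to f, i.e., every word of ⊥(e) admits some word of ⊥(f) as a suffix. -/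
open List

variable {Q A : Type*}

theorem aux_len (d : A → Q → Q) (r : Q → A → A) (u : List Q) :
    ∀ i, (mdel d r i u).length = u.length := by
  induction u with
  | nil => intro i; rfl
  | cons x u ih => intro i; simp [mdel, ih]

theorem aux_inj (d : A → Q → Q) (r : Q → A → A) (hrev : MReversible d) (u : List Q) :
    ∀ i v, mdel d r i u = mdel d r i v → u = v := by
  induction u with
  | nil => intro i v h; cases v with
    | nil => rfl
    | cons y v => simp [mdel] at h
  | cons x u ih => intro i v h; cases v with
    | nil => simp [mdel] at h
    | cons y v =>
      simp only [mdel, List.cons.injEq] at h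
      obtain ⟨h1, h2⟩ := h
      have hxy := (hrev i).1 h1
      subst hxy
      rw [ih _ _ h2]

theorem aux_app (d : A → Q → Q) (r : Q → A → A) (s t : List A) :
    ∀ u, mdelW d r (s ++ t) u = mdelW d r t (mdelW d r s u) := by
  induction s with
  | nil => intro u; rfl
  | cons i s ih => intro u; exact ih _

theorem aux_rep (d : A → Q → Q) (r : Q → A → A) (i : A) (k : ℕ) :
    ∀ u, mdelW d r (List.replicate k i) u = (mdel d r i)^[k] u := by
  induction k with
  | zero => intro u; rfl
  | succ k ih => intro u; exact ih _

theorem aux_step [Fintype Q] (d : A → Q → Q) (r : Q → A → A) (hrev : MReversible d)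
    (i : A) (u : List Q) : ∃ t, mdelW d r t (mdel d r i u) = u := by
  let g : List.Vector Q u.length → List.Vector Q u.length :=
    fun l => ⟨mdel d r i l.1, (aux_len d r l.1 i).trans l.2⟩
  have hg : Function.Injective g := fun a b h =>
    Subtype.ext (aux_inj d r hrev _ i _ (congrArg Subtype.val h))
  obtain ⟨k, hk, hp⟩ := hg.mem_periodicPts ⟨u, rfl⟩
  have hit : ∀ (m : ℕ) (l : List.Vector Q u.length), (g^[m] l).1 = (mdel d r i)^[m] l.1 := by
    intro m
    induction m with
    | zero => intro l; rfl
    | succ m ih => intro l; exact ih (g l)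
  obtain ⟨m, rfl⟩ : ∃ m, k = m + 1 := ⟨k - 1, by omega⟩
  refine ⟨List.replicate m i, ?_⟩
  rw [aux_rep]
  have := hit (m + 1) ⟨u, rfl⟩
  rw [hp] at this
  exact this.symm

theorem aux_inv [Fintype Q] (d : A → Q → Q) (r : Q → A → A) (hrev : MReversible d)
    (s : List A) : ∀ u, ∃ t, mdelW d r t (mdelW d r s u) = u := by
  induction s with
  | nil => intro u; exact ⟨[], rfl⟩
  | cons i s ih =>
    intro u
    obtain ⟨t, ht⟩ := ih (mdel d r i u)
    obtain ⟨t', ht'⟩ := aux_step d r hrev i u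
    exact ⟨t ++ t', by rw [aux_app]; simp only [mdelW]; rw [ht, ht']⟩

theorem aux_suf1 (d : A → Q → Q) (r : Q → A → A) (p w : List Q) :
    ∀ i, ∃ q j, mdel d r i (p ++ w) = q ++ mdel d r j w := by
  induction p with
  | nil => intro i; exact ⟨[], i, rfl⟩
  | cons x p ih =>
    intro i
    obtain ⟨q, j, h⟩ := ih (r x i)
    exact ⟨d i x :: q, j, by simp [mdel, h]⟩

theorem aux_suf (d : A → Q → Q) (r : Q → A → A) (s : List A) :
    ∀ p w, ∃ q t, mdelW d r s (p ++ w) = q ++ mdelW d r t w := by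
  induction s with
  | nil => intro p w; exact ⟨p, [], rfl⟩
  | cons i s ih =>
    intro p w
    obtain ⟨q, j, h⟩ := aux_suf1 d r p w i
    obtain ⟨q', t, h'⟩ := ih q (mdel d r j w)
    exact ⟨q', j :: t, by simp only [mdelW]; rw [h, h']⟩

/-- If some word of `⊥(e)` admits some word of `⊥(f)` as a suffix, then `e` is liftable
to `f` (every word of `⊥(e)` admits some word of `⊥(f)` as a suffix). -/
theorem statement4 [Fintype Q] [Fintype A] [Nonempty Q] [Nonempty A]
    (d : A → Q → Q) (r : Q → A → A) (hrev : MReversible d)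
    (e f : List Q) (he : e ≠ []) (hf : f ≠ [])
    (h : ∃ v ∈ mOrbit d r e, ∃ v' ∈ mOrbit d r f, v' <:+ v) :
    EdgeLiftable d r e f := by
  obtain ⟨v, ⟨s, hs⟩, v', ⟨t, ht⟩, p, hp⟩ := h
  rintro w ⟨s', hs'⟩
  obtain ⟨a, ha⟩ := aux_inv d r hrev s e
  obtain ⟨q, b, hb⟩ := aux_suf d r (a ++ s') p v'
  refine ⟨mdelW d r b v', ⟨t ++ b, by rw [aux_app, ht]⟩, q, ?_⟩
  rw [← hb, hp, ← hs, aux_app, ha, hs']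
end

section
/- Let A=(Q,Σ,δ,ρ) be a connected bireversible Mealy automaton whose orbit tree o(A) has no active self-liftable branch, and let j be a jungle tree of o(A) with trunk of length n. Then every j-word of length n·(1+#Q^n) admits a factor (contiguous subword) which is a cyclic j-word. -/
open List

variable {Q A : Type*}

/-- Prefix of length `m` of the infinite word `α : ℕ → Q`. -/
def branchPrefix (α : ℕ → Q) (m : ℕ) : List Q := (List.range m).map α

/-- The orbit tree admits an active self-liftable branch: a branch, represented by
an infinite word `α`, which is `k`-self-liftable for some `k ≥ 1` (every edge at
level `j + k` of the branch is liftable to the edge at level `j`), and active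
(its label sequence is not eventually `1`, i.e. the sizes of the components of the
prefixes do not become eventually constant). -/
def HasActiveSelfLiftableBranch (d : A → Q → Q) (r : Q → A → A) : Prop :=
  ∃ (α : ℕ → Q) (k : ℕ), 1 ≤ k ∧
    (∀ j : ℕ, 1 ≤ j → EdgeLiftable d r (branchPrefix α (j + k)) (branchPrefix α j)) ∧
    ∀ N : ℕ, ∃ m : ℕ, N ≤ m ∧
      (mOrbit d r (branchPrefix α (m + 1))).ncard ≠ (mOrbit d r (branchPrefix α m)).ncard

/-- `t` represents the trunk of a jungle tree: a non-empty finite initial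
`1`-self-liftable path (each edge of the trunk is liftable to the preceding one)
such that the bottom of the trunk has at least two legitimate children
(children liftable to the last trunk edge), and every legitimate child has label `1`. -/
def IsJungleTrunk (d : A → Q → Q) (r : Q → A → A) (t : List Q) : Prop :=
  t ≠ [] ∧
  (∀ j : ℕ, 2 ≤ j → j ≤ t.length → EdgeLiftable d r (t.take j) (t.take (j - 1))) ∧
  (∃ x y : Q, mOrbit d r (t ++ [x]) ≠ mOrbit d r (t ++ [y]) ∧
    EdgeLiftable d r (t ++ [x]) t ∧ EdgeLiftable d r (t ++ [y]) t) ∧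
  ∀ x : Q, EdgeLiftable d r (t ++ [x]) t →
    (mOrbit d r (t ++ [x])).ncard = (mOrbit d r t).ncard

/-- `u` is a `j`-word for the jungle tree with trunk `t`: the sequence of connected
components of the prefixes of `u` is an initial path of the jungle tree, i.e. the
component of each prefix of length `i ≤ |t|` coincides with the component of the
corresponding trunk prefix, and each deeper edge is liftable to the last trunk edge. -/
def IsJWord (d : A → Q → Q) (r : Q → A → A) (t u : List Q) : Prop :=
  (∀ i : ℕ, i ≤ u.length → i ≤ t.length → u.take i ∈ mOrbit d r (t.take i)) ∧
  ∀ l : ℕ, t.length ≤ l → l < u.length → EdgeLiftable d r (u.take (l + 1)) t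

/-- A stem is a `j`-word whose length is the length of the trunk. -/
def IsStem (d : A → Q → Q) (r : Q → A → A) (t u : List Q) : Prop :=
  IsJWord d r t u ∧ u.length = t.length

/-- A cyclic `j`-word is a finite word all of whose powers are `j`-words. -/
def IsCyclicJWord (d : A → Q → Q) (r : Q → A → A) (t u : List Q) : Prop :=
  ∀ k : ℕ, IsJWord d r t (List.flatten (List.replicate k u))

/-- The relation `∼` on stems: `u ∼ v` whenever there is `s` such that `u·s·v` is a
`j`-word and `ρ_{u·s}` acts like the identity on `Σ*`. -/
def StemEquiv (d : A → Q → Q) (r : Q → A → A) (t u v : List Q) : Prop :=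
  ∃ s : List Q, IsJWord d r t (u ++ s ++ v) ∧ ∀ w : List A, mrhoW d r (u ++ s) w = w

lemma aux_mdel_app (d : A → Q → Q) (r : Q → A → A) (p : List Q) : ∀ i : A,
    ∃ i' : A, ∀ q : List Q, mdel d r i (p ++ q) = mdel d r i p ++ mdel d r i' q := by
  induction p with
  | nil => intro i; exact ⟨i, fun q => by simp [mdel]⟩
  | cons x p ih =>
    intro i
    obtain ⟨i', h⟩ := ih (r x i)
    exact ⟨i', fun q => by simp [mdel, h]⟩

lemma aux_mdelW_app (d : A → Q → Q) (r : Q → A → A) (s : List A) : ∀ p q : List Q,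
    ∃ s' : List A, mdelW d r s (p ++ q) = mdelW d r s p ++ mdelW d r s' q := by
  induction s with
  | nil => intro p q; exact ⟨[], by simp [mdelW]⟩
  | cons i s ih =>
    intro p q
    obtain ⟨i', h⟩ := aux_mdel_app d r p i
    obtain ⟨s', h'⟩ := ih (mdel d r i p) (mdel d r i' q)
    exact ⟨i' :: s', by simp [mdelW, h, h']⟩

lemma aux_mdel_len (d : A → Q → Q) (r : Q → A → A) (p : List Q) : ∀ i : A,
    (mdel d r i p).length = p.length := by
  induction p with
  | nil => intro i; rfl
  | cons x p ih => intro i; simp [mdel, ih]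

lemma aux_mdelW_len (d : A → Q → Q) (r : Q → A → A) (s : List A) : ∀ p : List Q,
    (mdelW d r s p).length = p.length := by
  induction s with
  | nil => intro p; rfl
  | cons i s ih => intro p; simp [mdelW, ih, aux_mdel_len]

lemma aux_mdelW_comp (d : A → Q → Q) (r : Q → A → A) (s s' : List A) : ∀ p : List Q,
    mdelW d r s' (mdelW d r s p) = mdelW d r (s ++ s') p := by
  induction s with
  | nil => intro p; rfl
  | cons i s ih => intro p; simp [mdelW, ih]

lemma aux_orbit_take (d : A → Q → Q) (r : Q → A → A) (t w : List Q) (i : ℕ)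
    (h : w ∈ mOrbit d r t) (hi : i ≤ t.length) : w.take i ∈ mOrbit d r (t.take i) := by
  obtain ⟨s, rfl⟩ := h
  obtain ⟨s', h'⟩ := aux_mdelW_app d r s (t.take i) (t.drop i)
  refine ⟨s, ?_⟩
  rw [List.take_append_drop] at h'
  rw [h', List.take_left' (by rw [aux_mdelW_len]; simp [hi])]

lemma aux_windows (d : A → Q → Q) (r : Q → A → A) (t u : List Q) (hu : IsJWord d r t u)
    (w : List Q) (hw : w <:+: u) (hl : w.length = t.length) : w ∈ mOrbit d r t := by
  obtain ⟨a, b, rfl⟩ := hw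
  by_cases ha : a = []
  · subst ha
    have := hu.1 t.length (by simp [hl]) le_rfl
    rw [List.take_length, List.nil_append, List.take_left' hl] at this
    exact this
  · have hpos : 0 < a.length := List.length_pos_iff.2 ha
    have := hu.2 (a.length + w.length - 1) (by omega) (by simp; omega)
    rw [show a.length + w.length - 1 + 1 = (a ++ w).length by simp; omega, List.take_left] at this
    obtain ⟨v', ⟨s, hs⟩, hv'⟩ := this (a ++ w) ⟨[], rfl⟩
    have hlen : v'.length = w.length := by rw [← hs, aux_mdelW_len, hl]
    have h2 : w <:+ a ++ w := List.suffix_append _ _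
    have : v' = w := (List.suffix_of_suffix_length_le hv' h2 hlen.le).eq_of_length hlen
    exact this ▸ ⟨s, hs⟩

lemma aux_crit (d : A → Q → Q) (r : Q → A → A) (t x : List Q)
    (hx : x = [] ∨ t.length ≤ x.length)
    (h : ∀ w : List Q, w <:+: x → w.length = t.length → w ∈ mOrbit d r t) :
    IsJWord d r t x := by
  rcases hx with rfl | hx
  · refine ⟨fun i hi _ => ?_, fun l _ hl => by simp at hl⟩
    have : i = 0 := by simpa using hi
    subst this
    exact ⟨[], by simp [mdelW]⟩
  refine ⟨fun i _ hi => ?_, fun l hl hl' => ?_⟩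
  · have := aux_orbit_take d r t (x.take t.length) i
      (h _ (List.take_prefix _ _).isInfix (by simp [hx])) hi
    rwa [List.take_take, min_eq_left hi] at this
  · rintro v ⟨s, rfl⟩
    set y := x.take (l + 1) with hy
    have hyl : y.length = l + 1 := by simp [hy]; omega
    obtain ⟨s', h'⟩ := aux_mdelW_app d r s (y.take (l + 1 - t.length)) (y.drop (l + 1 - t.length))
    rw [List.take_append_drop] at h'
    obtain ⟨s0, hs0⟩ := h (y.drop (l + 1 - t.length))
      ((List.drop_suffix _ _).isInfix.trans (List.take_prefix _ _).isInfix)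
      (by simp [hyl]; omega)
    refine ⟨mdelW d r s' (y.drop (l + 1 - t.length)), ⟨s0 ++ s', ?_⟩, ?_⟩
    · rw [← aux_mdelW_comp, hs0]
    · rw [h']; exact List.suffix_append _ _

lemma aux_pow_infix (v s : List Q) (hs : s <+: v) (k : ℕ) : ∀ z : List Q,
    z.length ≤ s.length → z <:+: (List.replicate k v).flatten ++ s → z <:+: v ++ s := by
  induction k with
  | zero =>
    intro z _ h
    simp only [List.replicate_zero, List.flatten_nil, List.nil_append] at h
    exact h.trans (List.suffix_append _ _).isInfix
  | succ k ih =>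
    intro z hz h
    have hp : s <+: (List.replicate k v).flatten ++ s := by
      cases k with
      | zero => simp
      | succ k =>
        obtain ⟨e, rfl⟩ := hs
        simp [List.replicate_succ]
    obtain ⟨c, e, h⟩ := h
    rw [List.replicate_succ, List.flatten_cons, List.append_assoc v] at h
    have hc : c ++ z <+: v ++ ((List.replicate k v).flatten ++ s) := ⟨e, h⟩
    by_cases hcv : c.length ≤ v.length
    · have h1 : v ++ s <+: v ++ ((List.replicate k v).flatten ++ s) :=
        (List.prefix_append_right_inj v).2 hp
      have h2 : c ++ z <+: v ++ s :=
        List.prefix_of_prefix_length_le hc h1 (by simp; omega)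
      exact (List.suffix_append c z).isInfix.trans h2.isInfix
    · have h1 : v <+: c := List.prefix_of_prefix_length_le (List.prefix_append v _)
        ((List.prefix_append c z).trans hc) (by omega)
      obtain ⟨c', rfl⟩ := h1
      apply ih z hz
      simp only [List.append_assoc, List.append_cancel_left_eq] at h
      exact ⟨c', e, by simpa using h⟩

/-- Every `j`-word of length `n·(1 + #Q^n)` admits a (non-empty contiguous) factor which
is a cyclic `j`-word. -/
theorem statement8 [Fintype Q] [Fintype A] [Nonempty Q] [Nonempty A]
    (d : A → Q → Q) (r : Q → A → A)
    (hbi : MBireversible d r) (hconn : MConnected d r)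
    (hnab : ¬ HasActiveSelfLiftableBranch d r)
    (t : List Q) (ht : IsJungleTrunk d r t)
    (u : List Q) (hu : IsJWord d r t u)
    (hlen : u.length = t.length * (1 + Fintype.card Q ^ t.length)) :
    ∃ v : List Q, v ≠ [] ∧ v <:+: u ∧ IsCyclicJWord d r t v := by
  classical
  set n := t.length with hn
  have hn0 : 0 < n := List.length_pos_iff.2 ht.1
  set M := Fintype.card Q ^ n with hM
  have hlt : ∀ i : Fin (1 + M), i.1 * n + n ≤ u.length := by
    intro i
    have h1 : (i.1 + 1) * n ≤ (1 + M) * n := Nat.mul_le_mul_right n i.2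
    rw [hlen]
    nlinarith
  let f : Fin (1 + M) → List.Vector Q n := fun i =>
    ⟨(u.drop (i.1 * n)).take n, by have := hlt i; simp; omega⟩
  obtain ⟨i, j, hij, hf⟩ : ∃ i j, i < j ∧ f i = f j := by
    obtain ⟨i, j, hne, hf⟩ := Fintype.exists_ne_map_eq_of_card_lt f (by simp [card_vector, hM])
    rcases lt_or_gt_of_ne hne with h | h
    · exact ⟨i, j, h, hf⟩
    · exact ⟨j, i, h, hf.symm⟩
  have hf' : (u.drop (i.1 * n)).take n = (u.drop (j.1 * n)).take n := congrArg Subtype.val hf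
  have hij' : i.1 < j.1 := hij
  obtain ⟨c, hc⟩ : ∃ c, j.1 = i.1 + (c + 1) := ⟨j.1 - i.1 - 1, by omega⟩
  have hm : j.1 * n = i.1 * n + (c * n + n) := by rw [hc]; ring
  have hj := hlt j
  set y := u.drop (i.1 * n) with hy
  have hyl : c * n + n + n ≤ y.length := by simp [hy]; omega
  set s := y.take n with hs
  set v := y.take (c * n + n) with hv
  have hvs : v ++ s = y.take (c * n + n + n) := by
    rw [hf', hm, ← List.drop_drop, ← hy, hv, ← List.take_add]
  have hsl : s.length = n := by simp [hs]; omega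
  have hvl : n ≤ v.length := by simp [hv]; omega
  have hsv : s <+: v := List.take_prefix_take_left (by omega)
  have hyu : y <:+: u := (List.drop_suffix _ _).isInfix
  refine ⟨v, ?_, (List.take_prefix _ _).isInfix.trans hyu, fun k => ?_⟩
  · intro h; rw [h] at hvl; simp at hvl; omega
  · apply aux_crit
    · cases k with
      | zero => left; simp
      | succ k => right; rw [List.replicate_succ, List.flatten_cons, List.length_append]; omega
    · intro w hw hwl
      apply aux_windows d r t u hu w _ hwl
      have h1 := aux_pow_infix v s hsv k w (by omega)
        (hw.trans (List.prefix_append _ _).isInfix)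
      rw [hvs] at h1
      exact h1.trans ((List.take_prefix _ _).isInfix.trans hyu)
end

section
/- Let A=(Q,Σ,δ,ρ) be a connected bireversible Mealy automaton whose orbit tree o(A) has no active self-liftable branch, and let j be a jungle tree of o(A) with trunk of length n. If u·v and v·w are j-words with |v|≥n, then u·v·w is a j-word. -/
open List

variable {Q A : Type*}

theorem mdel_append_aux (d : A → Q → Q) (r : Q → A → A) (p e : List Q) (i : A) :
    ∃ (p' : List Q) (i' : A), mdel d r i (p ++ e) = p' ++ mdel d r i' e := by
  induction p generalizing i with
  | nil => exact ⟨[], i, rfl⟩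
  | cons x p ih =>
    obtain ⟨p', i', h⟩ := ih (r x i)
    exact ⟨d i x :: p', i', by simp [mdel, h]⟩

theorem mdelW_append_aux (d : A → Q → Q) (r : Q → A → A) (s : List A) (p e : List Q) :
    ∃ (p' : List Q) (s' : List A), mdelW d r s (p ++ e) = p' ++ mdelW d r s' e := by
  induction s generalizing p e with
  | nil => exact ⟨p, [], rfl⟩
  | cons i s ih =>
    obtain ⟨p', i', h⟩ := mdel_append_aux d r p e i
    obtain ⟨p'', s', h'⟩ := ih p' (mdel d r i' e)
    exact ⟨p'', i' :: s', by simp only [mdelW, h, h']⟩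

theorem EdgeLiftable_append_aux (d : A → Q → Q) (r : Q → A → A) (p e f : List Q)
    (h : EdgeLiftable d r e f) : EdgeLiftable d r (p ++ e) f := by
  rintro v ⟨s, rfl⟩
  obtain ⟨p', s', hs⟩ := mdelW_append_aux d r s p e
  obtain ⟨v', hv', hsuf⟩ := h (mdelW d r s' e) ⟨s', rfl⟩
  exact ⟨v', hv', hs ▸ hsuf.trans (List.suffix_append _ _)⟩

/-- If `u·v` and `v·w` are `j`-words with `|v| ≥ n` (the trunk length), then `u·v·w`
is a `j`-word. -/
theorem statement10 [Fintype Q] [Fintype A] [Nonempty Q] [Nonempty A]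
    (d : A → Q → Q) (r : Q → A → A)
    (hbi : MBireversible d r) (hconn : MConnected d r)
    (hnab : ¬ HasActiveSelfLiftableBranch d r)
    (t : List Q) (ht : IsJungleTrunk d r t)
    (u v w : List Q) (huv : IsJWord d r t (u ++ v)) (hvw : IsJWord d r t (v ++ w))
    (hv : t.length ≤ v.length) :
    IsJWord d r t (u ++ v ++ w) := by
  refine ⟨fun i hi hit => ?_, fun l hl hlt => ?_⟩
  · have h1 : i ≤ (u ++ v).length := by simp; omega
    rw [List.take_append_of_le_length h1]
    exact huv.1 i h1 hit
  · by_cases h1 : l < (u ++ v).length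
    · rw [List.take_append_of_le_length h1]
      exact huv.2 l hl h1
    · simp only [List.length_append] at h1 hlt
      obtain ⟨m, rfl⟩ : ∃ m, l = u.length + m := ⟨l - u.length, by omega⟩
      rw [List.append_assoc, Nat.add_assoc, List.take_length_add_append]
      exact EdgeLiftable_append_aux d r _ _ _
        (hvw.2 m (by omega) (by simp only [List.length_append]; omega))
end
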